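/- Assume 0 ≤ α < (β+γ)/2, 1 − γ < β ≤ 1, and 0 < γ ≤ 1 (region T₃). Then there exist M > 0 and functions λ₁, λ₃ : ℝ → ℂ such that for every μ > M, λ₁(μ), its complex conjugate, λ₃(μ), and its complex conjugate are roots of f(·, μ), and as μ → ∞: Re λ₁(μ) = −(1/2)(1+o(1)), Im λ₁(μ) = μ^(β/2)(1+o(1)), Re λ₃(μ) = −(1/2)μ^(2α−β−γ)(1+o(1)), and Im λ₃(μ) = √2 · μ^((1−γ)/2)(1+o(1)). -/

import Mathlib

open Filter Real Topology

/-- Characteristic polynomial of the thermoelastic system with Cattaneo's law,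
with inertial coefficient `m = 1`, wave speed `σ = 2`, relaxation `τ = 1`:
`f(λ, μ) = (μ^γ+1)λ⁴ + (μ^γ+1)λ³ + (μ^(2α)+μ^(β+γ)+2μ+μ^β)λ² + (μ^(2α)+2μ)λ + 2μ^(1+β)`. -/
noncomputable def charPoly (α β γ μ : ℝ) (l : ℂ) : ℂ :=
  ((μ ^ γ + 1 : ℝ) : ℂ) * l ^ 4 + ((μ ^ γ + 1 : ℝ) : ℂ) * l ^ 3 +
    ((μ ^ (2 * α) + μ ^ (β + γ) + 2 * μ + μ ^ β : ℝ) : ℂ) * l ^ 2 +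
    ((μ ^ (2 * α) + 2 * μ : ℝ) : ℂ) * l + ((2 * μ ^ (1 + β) : ℝ) : ℂ)

/-- The quartic `(λ²+λ+B)(λ²+w) + ελ(λ+1)` has a factorization
`(λ²+(1-c)λ+b)(λ²+cλ+d)`, close to the unperturbed one when `w` and `ε` are small against `B`. -/
lemma exists_quadratic_factors {B w ε : ℝ} (hB : 16 ≤ B) (hw : 1 ≤ w) (hε : 0 ≤ ε)
    (hwB : w ≤ B / 16) (hεB : ε ≤ B / 16) :
    ∃ b c d : ℝ, w / 2 ≤ d ∧ d ≤ 2 * w ∧ B / 2 ≤ b ∧ b * d = B * w ∧ c * (b - d) = w + ε - d ∧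
      b + d + c * (1 - c) = B + w + ε := by
  have hb : ∀ d ∈ Set.Icc (w / 2) (2 * w), B / 2 ≤ B * w / d := by
    intro d hd
    rw [le_div_iff₀ (by linarith [hd.1])]
    nlinarith [hd.2]
  set g : ℝ → ℝ := fun d => B * w / d + d +
    (w + ε - d) / (B * w / d - d) * (1 - (w + ε - d) / (B * w / d - d)) with hg
  have hcont : ContinuousOn g (Set.Icc (w / 2) (2 * w)) := by
    have hdiv : ContinuousOn (fun d : ℝ => B * w / d) (Set.Icc (w / 2) (2 * w)) :=
      continuousOn_const.div continuousOn_id fun d hd => by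
        have := hd.1
        linarith
    have hc : ContinuousOn (fun d : ℝ => (w + ε - d) / (B * w / d - d))
        (Set.Icc (w / 2) (2 * w)) :=
      ContinuousOn.div (by fun_prop) (hdiv.sub continuousOn_id) fun d hd => by
        have := hb d hd
        have := hd.2
        linarith
    exact (hdiv.add continuousOn_id).add (hc.mul (continuousOn_const.sub hc))
  have hleft : B + w + ε ≤ g (w / 2) := by
    have hB2 : B * w / (w / 2) = 2 * B := by field_simp
    have hden : 0 < 2 * B - w / 2 := by linarith
    have h0 : 0 ≤ (w + ε - w / 2) / (2 * B - w / 2) := div_nonneg (by linarith) hden.le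
    have h1 : (w + ε - w / 2) / (2 * B - w / 2) ≤ 1 := by
      rw [div_le_one hden]
      linarith
    simp only [hg, hB2]
    nlinarith [mul_nonneg h0 (sub_nonneg.2 h1)]
  have hright : g (2 * w) ≤ B + w + ε := by
    have hB2 : B * w / (2 * w) = B / 2 := by field_simp
    simp only [hg, hB2]
    nlinarith [sq_nonneg ((w + ε - 2 * w) / (B / 2 - 2 * w) - 1 / 2)]
  obtain ⟨d, hd, hgd⟩ := intermediate_value_Icc' (by linarith) hcont ⟨hright, hleft⟩
  have hd0 : d ≠ 0 := by linarith [hd.1]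
  have hden : B * w / d - d ≠ 0 := by linarith [hb d hd, hd.2]
  exact ⟨B * w / d, (w + ε - d) / (B * w / d - d), d, hd.1, hd.2, hb d hd,
    div_mul_cancel₀ _ hd0, div_mul_cancel₀ _ hden, hgd⟩

lemma abs_middle_coeff_le {B w ε b c d : ℝ} (hB : 0 < B) (hw : 0 < w) (hε : 0 ≤ ε)
    (hwB : w ≤ B / 16) (hdl : w / 2 ≤ d) (hdu : d ≤ 2 * w) (hb : B / 2 ≤ b)
    (hc : c * (b - d) = w + ε - d) : |c| ≤ 8 / 3 * (w / B + ε / B) := by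
  have hbd : 3 / 8 * B ≤ b - d := by linarith
  have hnum : |c| * (b - d) ≤ w + ε := by
    rw [← abs_of_pos (show 0 < b - d by linarith), ← abs_mul, hc]
    exact abs_le.2 ⟨by linarith, by linarith⟩
  rw [← add_div, ← mul_div_assoc, le_div_iff₀ hB]
  nlinarith [abs_nonneg c]

/-- Asymptotics of the factorization of `(λ²+λ+B)(λ²+w) + ελ(λ+1)` when `w, ε = o(B)`. -/
lemma exists_quadratic_factors_tendsto {B w ε : ℝ → ℝ} (hB : Tendsto B atTop atTop)
    (hw : ∀ᶠ μ in atTop, 1 ≤ w μ) (hε : ∀ᶠ μ in atTop, 0 < ε μ)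
    (hwB : Tendsto (fun μ => w μ / B μ) atTop (𝓝 0))
    (hεB : Tendsto (fun μ => ε μ / B μ) atTop (𝓝 0)) :
    ∃ b c d : ℝ → ℝ,
      (∀ᶠ μ in atTop, b μ * d μ = B μ * w μ ∧
        c μ * b μ + (1 - c μ) * d μ = w μ + ε μ ∧
        b μ + d μ + c μ * (1 - c μ) = B μ + w μ + ε μ ∧
        0 ≤ b μ - (1 - c μ) ^ 2 / 4 ∧ 0 ≤ d μ - c μ ^ 2 / 4) ∧
      Tendsto c atTop (𝓝 0) ∧ Tendsto (fun μ => b μ / B μ) atTop (𝓝 1) ∧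
      Tendsto (fun μ => d μ / w μ) atTop (𝓝 1) ∧
      Tendsto (fun μ => c μ / (ε μ / B μ)) atTop (𝓝 1) := by
  have hsize : ∀ᶠ μ in atTop, 16 ≤ B μ ∧ 1 ≤ w μ ∧ 0 < ε μ ∧
      w μ ≤ B μ / 16 ∧ ε μ ≤ B μ / 16 := by
    filter_upwards [hB.eventually_ge_atTop 16, hw, hε,
      hwB.eventually_le_const (show (0 : ℝ) < 1 / 16 by norm_num),
      hεB.eventually_le_const (show (0 : ℝ) < 1 / 16 by norm_num)] with μ h1 h2 h3 h4 h5
    rw [div_le_iff₀ (by linarith)] at h4 h5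
    exact ⟨h1, h2, h3, by linarith, by linarith⟩
  have hex : ∀ μ, ∃ t : ℝ × ℝ × ℝ, (16 ≤ B μ ∧ 1 ≤ w μ ∧ 0 < ε μ ∧
      w μ ≤ B μ / 16 ∧ ε μ ≤ B μ / 16) → w μ / 2 ≤ t.2.2 ∧ t.2.2 ≤ 2 * w μ ∧ B μ / 2 ≤ t.1 ∧
        t.1 * t.2.2 = B μ * w μ ∧ t.2.1 * (t.1 - t.2.2) = w μ + ε μ - t.2.2 ∧
        t.1 + t.2.2 + t.2.1 * (1 - t.2.1) = B μ + w μ + ε μ := by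
    intro μ
    by_cases h : 16 ≤ B μ ∧ 1 ≤ w μ ∧ 0 < ε μ ∧ w μ ≤ B μ / 16 ∧ ε μ ≤ B μ / 16
    · obtain ⟨b, c, d, hbcd⟩ := exists_quadratic_factors h.1 h.2.1 h.2.2.1.le h.2.2.2.1 h.2.2.2.2
      exact ⟨(b, c, d), fun _ => hbcd⟩
    · exact ⟨0, fun h' => absurd h' h⟩
  choose t ht using hex
  obtain ⟨b, hb⟩ : ∃ b : ℝ → ℝ, b = fun μ => (t μ).1 := ⟨_, rfl⟩
  obtain ⟨c, hc⟩ : ∃ c : ℝ → ℝ, c = fun μ => (t μ).2.1 := ⟨_, rfl⟩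
  obtain ⟨d, hd⟩ : ∃ d : ℝ → ℝ, d = fun μ => (t μ).2.2 := ⟨_, rfl⟩
  have key : ∀ᶠ μ in atTop, w μ / 2 ≤ d μ ∧ d μ ≤ 2 * w μ ∧ B μ / 2 ≤ b μ ∧
        b μ * d μ = B μ * w μ ∧ c μ * (b μ - d μ) = w μ + ε μ - d μ ∧
        b μ + d μ + c μ * (1 - c μ) = B μ + w μ + ε μ := by
    filter_upwards [hsize] with μ hμ
    subst hb hc hd
    exact ht μ hμ
  clear hb hc hd ht
  have hcabs : ∀ᶠ μ in atTop, |c μ| ≤ 8 / 3 * (w μ / B μ + ε μ / B μ) := by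
    filter_upwards [key, hsize] with μ ⟨k1, k2, k3, k4, k5, k6⟩ ⟨s1, s2, s3, s4, s5⟩
    exact abs_middle_coeff_le (by linarith) (by linarith) s3.le s4 k1 k2 k3 k5
  have hc0 : Tendsto c atTop (𝓝 0) :=
    squeeze_zero_norm' hcabs (by simpa using (hwB.add hεB).const_mul (8 / 3))
  have hdB : Tendsto (fun μ => d μ / B μ) atTop (𝓝 0) := by
    refine squeeze_zero' (g := fun μ => 2 * (w μ / B μ)) ?_ ?_ (by simpa using hwB.const_mul 2)
    · filter_upwards [key, hsize] with μ ⟨k1, _⟩ ⟨s1, s2, _⟩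
      exact div_nonneg (by linarith) (by linarith)
    · filter_upwards [key, hsize] with μ ⟨_, k2, _⟩ ⟨s1, _⟩
      rw [← mul_div_assoc]
      gcongr
  have hBinv : Tendsto (fun μ => (B μ)⁻¹) atTop (𝓝 0) := tendsto_inv_atTop_zero.comp hB
  have hone : Tendsto (fun μ => 1 - d μ / B μ) atTop (𝓝 1) := by
    simpa using hdB.const_sub 1
  have hwd : Tendsto (fun μ => w μ / d μ) atTop (𝓝 1) := by
    have hlim : Tendsto (fun μ => 1 + (ε μ / B μ - c μ * (1 - c μ) * (B μ)⁻¹) / (1 - d μ / B μ))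
        atTop (𝓝 (1 + (0 - 0 * (1 - 0) * 0) / 1)) :=
      ((hεB.sub ((hc0.mul (hc0.const_sub 1)).mul hBinv)).div hone one_ne_zero).const_add 1
    norm_num at hlim
    refine hlim.congr' ?_
    filter_upwards [key, hsize] with μ ⟨k1, k2, k3, k4, k5, k6⟩ ⟨s1, s2, s3, s4, s5⟩
    have hd0 : d μ ≠ 0 := by linarith
    have hB0 : B μ ≠ 0 := by linarith
    have hBd : B μ - d μ ≠ 0 := by linarith
    have hbeq : b μ = B μ * w μ / d μ := by rw [← k4]; field_simp
    have hfac : 1 - d μ / B μ = (B μ - d μ) / B μ := by field_simp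
    rw [hfac]
    field_simp
    linear_combination (-(d μ)) * k6 + k4
  have hbB : Tendsto (fun μ => b μ / B μ) atTop (𝓝 1) := by
    refine hwd.congr' ?_
    filter_upwards [key, hsize] with μ ⟨k1, k2, k3, k4, k5, k6⟩ ⟨s1, s2, s3, s4, s5⟩
    rw [div_eq_div_iff (by linarith) (by linarith)]
    linear_combination -k4
  refine ⟨b, c, d, ?_, hc0, hbB, ?_, ?_⟩
  · filter_upwards [key, hsize, hcabs] with μ ⟨k1, k2, k3, k4, k5, k6⟩ ⟨s1, s2, s3, s4, s5⟩ hcμ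
    have hBpos : 0 < B μ := by linarith
    have hwB' : w μ / B μ ≤ 1 / 16 := by rw [div_le_iff₀ hBpos]; linarith
    have hεB' : ε μ / B μ ≤ 1 / 16 := by rw [div_le_iff₀ hBpos]; linarith
    obtain ⟨hl, hu⟩ := abs_le.1 (show |c μ| ≤ 1 by linarith)
    exact ⟨k4, by linear_combination k5, k6, by nlinarith, by nlinarith⟩
  · simpa using hwd.inv₀ one_ne_zero
  · have hlim : Tendsto (fun μ => (1 + d μ / B μ * (1 - d μ / B μ)⁻¹) /
        (b μ / B μ - d μ / B μ + d μ / B μ * (1 - d μ / B μ)⁻¹ * ((1 - c μ) * (B μ)⁻¹)))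
        atTop (𝓝 ((1 + 0 * 1⁻¹) / (1 - 0 + 0 * 1⁻¹ * ((1 - 0) * 0)))) := by
      have hq := hdB.mul (hone.inv₀ one_ne_zero)
      exact (hq.const_add 1).div ((hbB.sub hdB).add (hq.mul ((hc0.const_sub 1).mul hBinv)))
        (by norm_num)
    norm_num at hlim
    have hden : ∀ᶠ μ in atTop, b μ / B μ - d μ / B μ +
        d μ / B μ * (1 - d μ / B μ)⁻¹ * ((1 - c μ) * (B μ)⁻¹) ≠ 0 := by
      have hq := hdB.mul (hone.inv₀ one_ne_zero)
      exact ((hbB.sub hdB).add (hq.mul ((hc0.const_sub 1).mul hBinv))).eventually_ne (by norm_num)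
    refine hlim.congr' ?_
    filter_upwards [key, hsize, hden] with μ ⟨k1, k2, k3, k4, k5, k6⟩ ⟨s1, s2, s3, s4, s5⟩ hne
    have hd0 : d μ ≠ 0 := by linarith
    have hB0 : B μ ≠ 0 := by linarith
    have hBd : B μ - d μ ≠ 0 := by linarith
    have hfac : 1 - d μ / B μ = (B μ - d μ) / B μ := by field_simp
    rw [hfac] at hne ⊢
    rw [div_eq_div_iff hne (div_ne_zero s3.ne' hB0)]
    field_simp
    linear_combination (-(B μ - d μ)) * k5 - d μ * k6 + k4

lemma quadratic_root {p q : ℝ} (h : 0 ≤ q - p ^ 2 / 4) :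
    (⟨-p / 2, √(q - p ^ 2 / 4)⟩ : ℂ) ^ 2 + p * ⟨-p / 2, √(q - p ^ 2 / 4)⟩ + q = 0 := by
  have hs := Real.sq_sqrt h
  set r := √(q - p ^ 2 / 4)
  apply Complex.ext
  · simp [pow_two]
    linear_combination -hs
  · simp [pow_two]
    ring

lemma charPoly_conj (α β γ μ : ℝ) (l : ℂ) :
    charPoly α β γ μ ((starRingEnd ℂ) l) = (starRingEnd ℂ) (charPoly α β γ μ l) := by
  simp only [charPoly, map_add, map_mul, map_pow, Complex.conj_ofReal]

lemma charPoly_eq_mul {α β γ μ b c d : ℝ} (hμ : 0 < μ)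
    (h0 : b * d = μ ^ β * (2 * μ / (μ ^ γ + 1)))
    (h1 : c * b + (1 - c) * d = 2 * μ / (μ ^ γ + 1) + μ ^ (2 * α) / (μ ^ γ + 1))
    (h2 : b + d + c * (1 - c) =
      μ ^ β + 2 * μ / (μ ^ γ + 1) + μ ^ (2 * α) / (μ ^ γ + 1)) (l : ℂ) :
    charPoly α β γ μ l =
      ((μ ^ γ + 1 : ℝ) : ℂ) * ((l ^ 2 + (1 - c : ℝ) * l + b) * (l ^ 2 + c * l + d)) := by
  have hD : 0 < μ ^ γ + 1 := by positivity
  have e0 : 2 * μ ^ (1 + β) = (μ ^ γ + 1) * (b * d) := by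
    rw [h0, rpow_add hμ, rpow_one]
    field_simp
  have e1 : μ ^ (2 * α) + 2 * μ = (μ ^ γ + 1) * (c * b + (1 - c) * d) := by
    rw [h1]
    field_simp
    ring
  have e2 : μ ^ (2 * α) + μ ^ (β + γ) + 2 * μ + μ ^ β =
      (μ ^ γ + 1) * (b + d + c * (1 - c)) := by
    rw [h2, rpow_add hμ]
    field_simp
    ring
  rw [charPoly, e0, e1, e2]
  push_cast
  ring

lemma rpow_div_rpow_add_one_tendsto {γ : ℝ} (hγ : 0 < γ) :
    Tendsto (fun μ : ℝ => μ ^ γ / (μ ^ γ + 1)) atTop (𝓝 1) := by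
  have h : Tendsto (fun μ : ℝ => 1 - (μ ^ γ + 1)⁻¹) atTop (𝓝 (1 - 0)) :=
    (tendsto_inv_atTop_zero.comp
      (tendsto_atTop_add_const_right _ 1 (tendsto_rpow_atTop hγ))).const_sub 1
  rw [sub_zero] at h
  refine h.congr' ?_
  filter_upwards [eventually_gt_atTop 0] with μ hμ
  have : 0 < μ ^ γ + 1 := by positivity
  field_simp
  ring

theorem charPoly_roots_T3 (α β γ : ℝ)
    (h1 : 0 ≤ α) (h2 : α < (β + γ) / 2) (h3 : 1 - γ < β) (h4 : β ≤ 1)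
    (h5 : 0 < γ) (h6 : γ ≤ 1) :
    ∃ M > (0 : ℝ), ∃ l1 l3 : ℝ → ℂ,
      (∀ μ > M,
        charPoly α β γ μ (l1 μ) = 0 ∧ charPoly α β γ μ ((starRingEnd ℂ) (l1 μ)) = 0 ∧
        charPoly α β γ μ (l3 μ) = 0 ∧ charPoly α β γ μ ((starRingEnd ℂ) (l3 μ)) = 0) ∧
      Tendsto (fun μ : ℝ => (l1 μ).re / (-(1 / 2) : ℝ)) atTop (𝓝 1) ∧
      Tendsto (fun μ : ℝ => (l1 μ).im / (μ ^ (β / 2))) atTop (𝓝 1) ∧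
      Tendsto (fun μ : ℝ => (l3 μ).re / (-(1 / 2) * μ ^ (2 * α - β - γ))) atTop (𝓝 1) ∧
      Tendsto (fun μ : ℝ => (l3 μ).im / (Real.sqrt 2 * μ ^ ((1 - γ) / 2))) atTop (𝓝 1) := by
  have hβ : 0 < β := by linarith
  have hratio := rpow_div_rpow_add_one_tendsto h5
  have hneg : ∀ s : ℝ, s < 0 → Tendsto (fun μ : ℝ => μ ^ s) atTop (𝓝 0) := fun s hs => by
    simpa using tendsto_rpow_neg_atTop (neg_pos.2 hs)
  have hw_eq : ∀ μ : ℝ, 0 < μ →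
      2 * μ / (μ ^ γ + 1) = 2 * μ ^ (1 - γ) * (μ ^ γ / (μ ^ γ + 1)) := fun μ hμ => by
    rw [rpow_sub hμ, rpow_one]
    field_simp
  have hε_eq : ∀ μ : ℝ, 0 < μ → μ ^ (2 * α) / (μ ^ γ + 1) / μ ^ β =
      μ ^ (2 * α - β - γ) * (μ ^ γ / (μ ^ γ + 1)) := fun μ hμ => by
    rw [rpow_sub hμ, rpow_sub hμ]
    field_simp
  have hw1 : ∀ᶠ μ : ℝ in atTop, 1 ≤ 2 * μ / (μ ^ γ + 1) := by
    filter_upwards [eventually_ge_atTop 1] with μ hμ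
    have hle : μ ^ γ ≤ μ := by simpa using rpow_le_rpow_of_exponent_le hμ h6
    rw [le_div_iff₀ (by positivity)]
    linarith
  have hwB : Tendsto (fun μ : ℝ => 2 * μ / (μ ^ γ + 1) / μ ^ β) atTop (𝓝 0) := by
    have h := ((hneg (1 - γ - β) (by linarith)).const_mul 2).mul hratio
    rw [mul_zero, zero_mul] at h
    refine h.congr' ?_
    filter_upwards [eventually_gt_atTop 0] with μ hμ
    rw [hw_eq μ hμ, rpow_sub hμ (1 - γ)]
    field_simp
  have hεB : Tendsto (fun μ : ℝ => μ ^ (2 * α) / (μ ^ γ + 1) / μ ^ β) atTop (𝓝 0) := by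
    have h := (hneg (2 * α - β - γ) (by linarith)).mul hratio
    rw [zero_mul] at h
    refine h.congr' ?_
    filter_upwards [eventually_gt_atTop 0] with μ hμ
    exact (hε_eq μ hμ).symm
  obtain ⟨b, c, d, hbcd, hc, hb, hd, hcε⟩ :=
    exists_quadratic_factors_tendsto (tendsto_rpow_atTop hβ) hw1
      (by filter_upwards [eventually_gt_atTop 0] with μ hμ; positivity) hwB hεB
  obtain ⟨M, hM⟩ := eventually_atTop.1 hbcd
  refine ⟨max M 1, by positivity, fun μ => ⟨-(1 - c μ) / 2, √(b μ - (1 - c μ) ^ 2 / 4)⟩,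
    fun μ => ⟨-c μ / 2, √(d μ - c μ ^ 2 / 4)⟩, ?_, ?_, ?_, ?_, ?_⟩
  · intro μ hμ
    obtain ⟨k0, k1, k2, hb0, hd0⟩ := hM μ ((le_max_left M 1).trans hμ.le)
    have hμ0 : 0 < μ := by linarith [le_max_right M 1]
    have hfac := charPoly_eq_mul hμ0 k0 k1 k2
    have hr1 := hfac ⟨-(1 - c μ) / 2, √(b μ - (1 - c μ) ^ 2 / 4)⟩
    have hr3 := hfac ⟨-c μ / 2, √(d μ - c μ ^ 2 / 4)⟩
    rw [quadratic_root hb0, zero_mul, mul_zero] at hr1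
    rw [quadratic_root hd0, mul_zero, mul_zero] at hr3
    refine ⟨hr1, ?_, hr3, ?_⟩
    · rw [charPoly_conj, hr1, map_zero]
    · rw [charPoly_conj, hr3, map_zero]
  · have h := hc.const_sub 1
    rw [sub_zero] at h
    refine h.congr fun μ => ?_
    ring
  · have h := (hb.sub ((((hc.const_sub 1).pow 2).div_const 4).mul
      (hneg (-β) (by linarith)))).sqrt
    simp only [mul_zero, sub_zero, sqrt_one] at h
    refine h.congr' ?_
    filter_upwards [eventually_gt_atTop 0] with μ hμ
    have hsq : μ ^ (β / 2) = √(μ ^ β) := by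
      rw [sqrt_eq_rpow, ← rpow_mul hμ.le]
      ring_nf
    rw [hsq, ← sqrt_div' _ (by positivity), rpow_neg hμ.le]
    congr 1
    field_simp
  · have h := hcε.mul hratio
    rw [mul_one] at h
    refine h.congr' ?_
    filter_upwards [eventually_gt_atTop 0] with μ hμ
    rw [hε_eq μ hμ]
    have : 0 < μ ^ (2 * α - β - γ) := by positivity
    field_simp
  · have hbdd : Tendsto (fun μ : ℝ => c μ ^ 2 / 4 / (2 * μ ^ (1 - γ))) atTop (𝓝 0) := by
      have h := (hc.pow 2)
      rw [zero_pow two_ne_zero] at h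
      refine squeeze_zero' ?_ ?_ h
      · filter_upwards [eventually_gt_atTop 0] with μ hμ
        positivity
      · filter_upwards [eventually_ge_atTop 1] with μ hμ
        have h1 : 1 ≤ μ ^ (1 - γ) := one_le_rpow hμ (by linarith)
        rw [div_le_iff₀ (by positivity)]
        nlinarith [sq_nonneg (c μ)]
    have h := ((hd.mul hratio).sub hbdd).sqrt
    simp only [mul_one, sub_zero, sqrt_one] at h
    refine h.congr' ?_
    filter_upwards [eventually_gt_atTop 0] with μ hμ
    have hsq : √2 * μ ^ ((1 - γ) / 2) = √(2 * μ ^ (1 - γ)) := by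
      rw [sqrt_mul zero_le_two, sqrt_eq_rpow (μ ^ (1 - γ)), ← rpow_mul hμ.le]
      ring_nf
    rw [hsq, ← sqrt_div' _ (by positivity), hw_eq μ hμ]
    congr 1
    field_simp
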